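/- Let ν ∈ 𝒱₀, let f1, f2 ∈ k[Q] be algebraically independent over k, let R ∈ k[X,Y], and let n ≥ 1 be an integer with ∂_Y^n R ≠ 0. Let ν0 be the monomial valuation on k[X,Y] with weights (ν(f1), ν(f2)). If ν((∂_Y^n R)(f1,f2)) = ν0(∂_Y^n R), then ν(R(f1,f2)) < deg_Y(R)·ν(f2) + n·∇(f1,f2). -/

import Mathlib

noncomputable section

open MvPolynomial

/-- The polynomial `q = xt - yz` in `k[x,y,z,t]` (variables `x,y,z,t` are `X 0, X 1, X 2, X 3`). -/
def qpoly (k : Type) [Field k] : MvPolynomial (Fin 4) k :=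
  X 0 * X 3 - X 1 * X 2

/-- The coordinate ring `k[Q] = k[x,y,z,t]/(xt - yz - 1)` of the affine quadric threefold. -/
abbrev QuadRing (k : Type) [Field k] : Type :=
  MvPolynomial (Fin 4) k ⧸ Ideal.span {qpoly k - 1}

/-- The canonical projection `π : k[x,y,z,t] → k[Q]`. -/
def qmk (k : Type) [Field k] : MvPolynomial (Fin 4) k →+* QuadRing k :=
  Ideal.Quotient.mk (Ideal.span {qpoly k - 1})

/-- A valuation on a commutative `k`-algebra `A`, with values in `ℝ ∪ {+∞}`:
`ν⁻¹({+∞}) = {0}`, `ν(a) = 0` for `a ∈ k*`, `ν(fg) = ν f + ν g`, and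
`ν(f + g) ≥ min (ν f) (ν g)`. -/
def IsValuation (k : Type) [Field k] (A : Type) [CommRing A] [Algebra k A]
    (ν : A → WithTop ℝ) : Prop :=
  (∀ f : A, ν f = ⊤ ↔ f = 0) ∧
  (∀ a : k, a ≠ 0 → ν (algebraMap k A a) = 0) ∧
  (∀ f g : A, ν (f * g) = ν f + ν g) ∧
  (∀ f g : A, min (ν f) (ν g) ≤ ν (f + g))

/-- The monomial valuation `ν_p^α` on `k[x,y,z,t]` at the point `p` with weights `α`:
the minimum of `⟨I, α⟩` over the exponents `I` appearing in the expansion of `R` in the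
shifted variables `x - p₀, y - p₁, z - p₂, t - p₃` (and `+∞` on the zero polynomial). -/
def mvalP (k : Type) [Field k] (p : Fin 4 → k) (α : Fin 4 → ℝ)
    (R : MvPolynomial (Fin 4) k) : WithTop ℝ :=
  (MvPolynomial.aeval (fun i => X i + C (p i)) R : MvPolynomial (Fin 4) k).support.inf
    fun I => ((∑ i, α i * (I i : ℝ) : ℝ) : WithTop ℝ)

/-- The monomial valuation `ν_0^α` on `k[x,y,z,t]` at the origin with weights `α`. -/
def mvalO (k : Type) [Field k] (α : Fin 4 → ℝ)
    (R : MvPolynomial (Fin 4) k) : WithTop ℝ :=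
  R.support.inf fun I => ((∑ i, α i * (I i : ℝ) : ℝ) : WithTop ℝ)

/-- The map `ν : k[Q] → ℝ ∪ {+∞}` given by `ν(f) = sup {ν_p^α(R) : π R = f}`. -/
def nuSup (k : Type) [Field k] (p : Fin 4 → k) (α : Fin 4 → ℝ)
    (f : QuadRing k) : WithTop ℝ :=
  sSup {v : WithTop ℝ | ∃ R : MvPolynomial (Fin 4) k, qmk k R = f ∧ mvalP k p α R = v}

/-- The set `𝒱₀` of valuations on `k[Q]` obtained from monomial valuations at points
`p ∈ k⁴` with weights `α ∈ (ℝ^{<0})⁴` satisfying `α₀ + α₃ = α₁ + α₂`. -/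
def V0 (k : Type) [Field k] : Set (QuadRing k → WithTop ℝ) :=
  {ν | ∃ (p : Fin 4 → k) (α : Fin 4 → ℝ),
      (∀ i, α i < 0) ∧ α 0 + α 3 = α 1 + α 2 ∧ ν = nuSup k p α}

/-- The Jacobian determinant `Jac(R₁,R₂,R₃,R₄)` of four polynomials in `k[x,y,z,t]`. -/
def jac (k : Type) [Field k] (R : Fin 4 → MvPolynomial (Fin 4) k) :
    MvPolynomial (Fin 4) k :=
  (Matrix.of fun i j : Fin 4 => MvPolynomial.pderiv j (R i)).det

/-- The monomial valuation on `k[X,Y]` with weights `w = (w₁, w₂)`. -/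
def mval2 (k : Type) [Field k] (w : Fin 2 → ℝ)
    (R : MvPolynomial (Fin 2) k) : WithTop ℝ :=
  R.support.inf fun I => ((∑ i, w i * (I i : ℝ) : ℝ) : WithTop ℝ)

open Classical in
/-- The `(w₁,w₂)`-leading part of `R ∈ k[X,Y]`: the sum of the terms of `R` whose
weighted degree realizes the monomial valuation of `R` with weights `w`. -/
def leadPart2 (k : Type) [Field k] (w : Fin 2 → ℝ) (R : MvPolynomial (Fin 2) k) :
    MvPolynomial (Fin 2) k :=
  ∑ I ∈ R.support.filter
      (fun I => ((∑ i, w i * (I i : ℝ) : ℝ) : WithTop ℝ) = mval2 k w R),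
    monomial I (R.coeff I)

open Classical in
/-- The `α`-leading part `R^w` of `R ∈ k[x,y,z,t]` (with respect to the monomial
valuation at the origin with weights `α`). -/
def leadPart4 (k : Type) [Field k] (α : Fin 4 → ℝ) (R : MvPolynomial (Fin 4) k) :
    MvPolynomial (Fin 4) k :=
  ∑ I ∈ R.support.filter
      (fun I => ((∑ i, α i * (I i : ℝ) : ℝ) : WithTop ℝ) = mvalO k α R),
    monomial I (R.coeff I)

/-- `(f₁, f₂)` is a component of an automorphism of `Q`: there is a `k`-algebra
automorphism `σ` of `k[Q]` with `σ x = f₁` and `σ y = f₂`. -/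
def IsComponent (k : Type) [Field k] (f1 f2 : QuadRing k) : Prop :=
  ∃ σ : QuadRing k ≃ₐ[k] QuadRing k, σ (qmk k (X 0)) = f1 ∧ σ (qmk k (X 1)) = f2

/-- `(f₁, f₂)` is critically resonant with respect to `ν`. -/
def CriticallyResonant (k : Type) [Field k] (ν : QuadRing k → WithTop ℝ)
    (f1 f2 : QuadRing k) : Prop :=
  (∃ (m : ℕ) (lam : k), 1 ≤ m ∧ lam ≠ 0 ∧
      ν f1 < ν (f1 - algebraMap k (QuadRing k) lam * f2 ^ m) ∧ ν f1 = m • ν f2) ∨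
  (∃ (m : ℕ) (lam : k), 1 ≤ m ∧ lam ≠ 0 ∧
      ν f2 < ν (f2 - algebraMap k (QuadRing k) lam * f1 ^ m) ∧ ν f2 = m • ν f1)

section WeightFiltration

variable {σ R : Type*} [CommRing R]

/-- The submodule of polynomials all of whose monomials have `α`-weight at least `v`. -/
def weightGE (R : Type*) [CommRing R] (α : σ → ℝ) (v : ℝ) : Submodule R (MvPolynomial σ R) :=
  restrictSupport R {I | v ≤ Finsupp.weight α I}

theorem mem_weightGE {α : σ → ℝ} {v : ℝ} {P : MvPolynomial σ R} :
    P ∈ weightGE R α v ↔ ∀ I, coeff I P ≠ 0 → v ≤ Finsupp.weight α I := by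
  rw [weightGE, mem_restrictSupport_iff]
  simp [Set.subset_def]

theorem weightGE_anti {α : σ → ℝ} {v w : ℝ} (h : v ≤ w) : weightGE R α w ≤ weightGE R α v :=
  fun _ hP => mem_weightGE.2 fun I hI => h.trans (mem_weightGE.1 hP I hI)

theorem mul_mem_weightGE {α : σ → ℝ} {v w : ℝ} {P S : MvPolynomial σ R}
    (hP : P ∈ weightGE R α v) (hS : S ∈ weightGE R α w) : P * S ∈ weightGE R α (v + w) := by
  classical
  refine mem_weightGE.2 fun I hI => ?_
  rw [coeff_mul] at hI
  obtain ⟨⟨J, K⟩, hJK, hne⟩ := Finset.exists_ne_zero_of_sum_ne_zero hI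
  rw [Finset.HasAntidiagonal.mem_antidiagonal] at hJK
  rw [← hJK, map_add]
  exact add_le_add (mem_weightGE.1 hP J (left_ne_zero_of_mul hne))
    (mem_weightGE.1 hS K (right_ne_zero_of_mul hne))

theorem C_mem_weightGE {α : σ → ℝ} (c : R) : (C c : MvPolynomial σ R) ∈ weightGE R α 0 := by
  classical
  refine mem_weightGE.2 fun I hI => ?_
  rw [coeff_C] at hI
  have : 0 = I := by by_contra h; simp [h] at hI
  simp [← this]

theorem X_mem_weightGE {α : σ → ℝ} (i : σ) : (X i : MvPolynomial σ R) ∈ weightGE R α (α i) := by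
  classical
  refine mem_weightGE.2 fun I hI => ?_
  rw [coeff_X] at hI
  have : Finsupp.single i 1 = I := by by_contra h; simp [h] at hI
  simp [← this, Finsupp.weight_single]

theorem prod_mem_weightGE {ι : Type*} {α : σ → ℝ} (s : Finset ι) {v : ι → ℝ}
    {P : ι → MvPolynomial σ R} (h : ∀ i ∈ s, P i ∈ weightGE R α (v i)) :
    ∏ i ∈ s, P i ∈ weightGE R α (∑ i ∈ s, v i) := by
  classical
  induction s using Finset.induction_on with
  | empty => simpa using C_mem_weightGE (α := α) (1 : R)
  | insert i s hi ih =>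
    rw [Finset.prod_insert hi, Finset.sum_insert hi]
    exact mul_mem_weightGE (h i (Finset.mem_insert_self i s))
      (ih fun j hj => h j (Finset.mem_insert_of_mem hj))

theorem pderiv_mem_weightGE {α : σ → ℝ} {v : ℝ} {P : MvPolynomial σ R}
    (hP : P ∈ weightGE R α v) (i : σ) : pderiv i P ∈ weightGE R α (v - α i) := by
  refine mem_weightGE.2 fun I hI => ?_
  rw [coeff_pderiv] at hI
  have := mem_weightGE.1 hP _ (left_ne_zero_of_mul hI)
  rw [map_add, Finsupp.weight_single, one_smul] at this
  linarith

theorem det_mem_weightGE {n : Type*} [Fintype n] [DecidableEq n] {α : σ → ℝ} {u v : n → ℝ}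
    {M : Matrix n n (MvPolynomial σ R)} (h : ∀ i j, M i j ∈ weightGE R α (u i - v j)) :
    M.det ∈ weightGE R α (∑ i, u i - ∑ j, v j) := by
  rw [Matrix.det_apply]
  refine Submodule.sum_mem _ fun τ _ => ?_
  have hprod := prod_mem_weightGE Finset.univ (fun i _ => h (τ i) i)
  rw [Finset.sum_sub_distrib, Equiv.sum_comp τ u] at hprod
  rcases Int.units_eq_one_or (Equiv.Perm.sign τ) with hs | hs <;> rw [hs]
  · simpa using hprod
  · simpa using neg_mem hprod

/-- When the weights are nonpositive, translations preserve the filtration. -/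
theorem translate_mem_weightGE {α : σ → ℝ} (hα : ∀ i, α i ≤ 0) (p : σ → R)
    {v : ℝ} {P : MvPolynomial σ R} (hP : P ∈ weightGE R α v) :
    aeval (fun i => (X i + C (p i) : MvPolynomial σ R)) P ∈ weightGE R α v := by
  rw [aeval_def, eval₂_eq]
  refine Submodule.sum_mem _ fun I hI => weightGE_anti (mem_weightGE.1 hP I (mem_support_iff.1 hI)) ?_
  rw [← zero_add (Finsupp.weight α I)]
  refine mul_mem_weightGE (C_mem_weightGE _) ?_
  rw [Finsupp.weight_apply, Finsupp.sum]
  refine prod_mem_weightGE _ fun i _ => ?_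
  have hX : (X i + C (p i) : MvPolynomial σ R) ∈ weightGE R α (α i) :=
    add_mem (X_mem_weightGE i) (weightGE_anti (hα i) (C_mem_weightGE _))
  simpa using prod_mem_weightGE (Finset.range (I i)) fun _ _ => hX

theorem translate_mem_weightGE_iff {α : σ → ℝ} (hα : ∀ i, α i ≤ 0) (p : σ → R)
    {v : ℝ} {P : MvPolynomial σ R} :
    aeval (fun i => (X i + C (p i) : MvPolynomial σ R)) P ∈ weightGE R α v ↔
      P ∈ weightGE R α v := by
  refine ⟨fun h => ?_, translate_mem_weightGE hα p⟩
  have h' := translate_mem_weightGE hα (-p) h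
  have hid : (aeval fun i => (X i + C ((-p) i) : MvPolynomial σ R)).comp
      (aeval fun i => (X i + C (p i) : MvPolynomial σ R)) = AlgHom.id R _ := by
    ext i : 1
    simp
  rw [← AlgHom.comp_apply, hid] at h'
  exact h'

theorem weightedHomogeneousComponent_mul {α : σ → ℝ} {v w : ℝ} {P S : MvPolynomial σ R}
    (h : ∀ J K, coeff J P ≠ 0 → coeff K S ≠ 0 →
      Finsupp.weight α J + Finsupp.weight α K = v + w →
        Finsupp.weight α J = v ∧ Finsupp.weight α K = w) :
    weightedHomogeneousComponent α (v + w) (P * S) =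
      weightedHomogeneousComponent α v P * weightedHomogeneousComponent α w S := by
  classical
  ext I
  rw [coeff_weightedHomogeneousComponent, coeff_mul, coeff_mul, Finset.ite_sum_zero]
  refine Finset.sum_congr rfl fun x hx => ?_
  obtain ⟨J, K⟩ := x
  rw [Finset.HasAntidiagonal.mem_antidiagonal] at hx
  simp only [coeff_weightedHomogeneousComponent, ← hx, map_add]
  by_cases hJ : coeff J P = 0
  · simp [hJ]
  by_cases hK : coeff K S = 0
  · simp [hK]
  have := h J K hJ hK
  by_cases hs : Finsupp.weight α J + Finsupp.weight α K = v + w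
  · simp [this hs]
  · rw [if_neg hs]
    split_ifs with h1 h2 <;> simp_all

theorem weightedHomogeneousComponent_mul_of_mem {α : σ → ℝ} {v w : ℝ} {P S : MvPolynomial σ R}
    (hP : P ∈ weightGE R α v) (hS : S ∈ weightGE R α w) :
    weightedHomogeneousComponent α (v + w) (P * S) =
      weightedHomogeneousComponent α v P * weightedHomogeneousComponent α w S := by
  refine weightedHomogeneousComponent_mul fun J K hJ hK h => ?_
  have h1 := mem_weightGE.1 hP J hJ
  have h2 := mem_weightGE.1 hS K hK
  constructor <;> linarith

theorem weightedHomogeneousComponent_eq_zero_of_mem {α : σ → ℝ} {v w : ℝ}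
    {P : MvPolynomial σ R} (hP : P ∈ weightGE R α w) (h : v < w) :
    weightedHomogeneousComponent α v P = 0 := by
  classical
  ext I
  rw [coeff_weightedHomogeneousComponent, coeff_zero]
  split_ifs with hI
  · by_contra hne
    linarith [mem_weightGE.1 hP I hne]
  · rfl

theorem exists_weightedHomogeneousComponent_ne_zero (α : σ → ℝ) {P : MvPolynomial σ R}
    (hP : P ≠ 0) : ∃ v, P ∈ weightGE R α v ∧ weightedHomogeneousComponent α v P ≠ 0 := by
  classical
  obtain ⟨I, hI, hmin⟩ := P.support.exists_min_image (Finsupp.weight α) (support_nonempty.2 hP)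
  refine ⟨Finsupp.weight α I, mem_weightGE.2 fun J hJ => hmin J (mem_support_iff.2 hJ), fun h => ?_⟩
  have := congrArg (coeff I) h
  rw [coeff_weightedHomogeneousComponent, if_pos rfl] at this
  exact mem_support_iff.1 hI this

theorem exists_weight_eq_of_weightedHomogeneousComponent_ne_zero {α : σ → ℝ} {v : ℝ}
    {P : MvPolynomial σ R} (h : weightedHomogeneousComponent α v P ≠ 0) :
    ∃ I, coeff I P ≠ 0 ∧ Finsupp.weight α I = v := by
  by_contra! hP
  exact h (weightedHomogeneousComponent_eq_zero' v P fun I hI => hP I (mem_support_iff.1 hI))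

theorem finite_setOf_le_weight [Fintype σ] {α : σ → ℝ} (hα : ∀ i, α i < 0) (v : ℝ) :
    {I : σ →₀ ℕ | v ≤ Finsupp.weight α I}.Finite := by
  classical
  refine (Set.finite_Iic (Finsupp.equivFunOnFinite.symm fun i => ⌈v / α i⌉₊)).subset
    fun I hI i => ?_
  have hle : Finsupp.weight α I ≤ I i * α i := by
    rw [Finsupp.weight_eq_sum, ← Finset.add_sum_erase _ _ (Finset.mem_univ i), nsmul_eq_mul]
    refine add_le_of_nonpos_right (Finset.sum_nonpos fun j _ => ?_)
    exact nsmul_nonpos (hα j).le _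
  have : (I i : ℝ) ≤ v / α i := (le_div_iff_of_neg (hα i)).2 (le_trans hI hle)
  exact_mod_cast this.trans (Nat.le_ceil _)

end WeightFiltration

theorem prime_qpoly (k : Type) [Field k] : Prime (qpoly k) := by
  classical
  have h03 : (0 : Fin 4) ∉ (X 3 : MvPolynomial (Fin 4) k).vars := by simp
  have hvars : (X 1 * X 2 : MvPolynomial (Fin 4) k).vars ⊆ {1, 2} :=
    (vars_mul _ _).trans (by simp [vars_X])
  have hirr : Irreducible (X 0 * X 3 + -(X 1 * X 2) : MvPolynomial (Fin 4) k) := by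
    refine irreducible_mul_X_add _ _ 3 (X_ne_zero _) (by simp [vars_X]) ?_ ?_
    · rw [vars_neg]
      exact fun h => by simpa using hvars h
    · rw [IsRelPrime.neg_right_iff]
      refine ((X_prime (R := k) (σ := Fin 4) (i := 0)).irreducible.isRelPrime_iff_not_dvd).2 fun h => ?_
      rcases (X_prime (R := k) (σ := Fin 4) (i := 0)).dvd_or_dvd h with h | h <;> simp [X_dvd_X] at h
  rw [qpoly, sub_eq_add_neg]
  exact hirr.prime

section QuadricValuation

variable {k : Type} [Field k]

theorem le_mvalP_iff {p : Fin 4 → k} {α : Fin 4 → ℝ} (hα : ∀ i, α i ≤ 0) {v : ℝ}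
    {P : MvPolynomial (Fin 4) k} : (v : WithTop ℝ) ≤ mvalP k p α P ↔ P ∈ weightGE k α v := by
  rw [mvalP, Finset.le_inf_iff, ← translate_mem_weightGE_iff hα p, mem_weightGE]
  refine forall_congr' fun I => ?_
  rw [mem_support_iff, WithTop.coe_le_coe, Finsupp.weight_eq_sum]
  simp only [nsmul_eq_mul, mul_comm]

theorem isLUB_nuSup (p : Fin 4 → k) (α : Fin 4 → ℝ) (f : QuadRing k) :
    IsLUB {v : WithTop ℝ | ∃ R : MvPolynomial (Fin 4) k, qmk k R = f ∧ mvalP k p α R = v}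
      (nuSup k p α f) := by
  obtain ⟨R, hR⟩ := Ideal.Quotient.mk_surjective f
  exact WithTop.isLUB_sSup' ⟨_, R, hR, rfl⟩

theorem le_nuSup {p : Fin 4 → k} {α : Fin 4 → ℝ} (hα : ∀ i, α i ≤ 0) {v : ℝ}
    {P : MvPolynomial (Fin 4) k} (hP : P ∈ weightGE k α v) :
    (v : WithTop ℝ) ≤ nuSup k p α (qmk k P) :=
  ((le_mvalP_iff hα).2 hP).trans ((isLUB_nuSup p α _).1 ⟨P, rfl, rfl⟩)

theorem qmk_qpoly_sub_one : qmk k (qpoly k - 1) = 0 :=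
  Ideal.Quotient.eq_zero_iff_mem.2 (Ideal.mem_span_singleton_self _)

theorem qmk_eq_qmk_iff {P S : MvPolynomial (Fin 4) k} :
    qmk k P = qmk k S ↔ ∃ H, P = S + (qpoly k - 1) * H := by
  rw [qmk, Ideal.Quotient.eq, Ideal.mem_span_singleton, dvd_def]
  simp only [sub_eq_iff_eq_add']

theorem coeff_qpoly_weight {α : Fin 4 → ℝ} (hsum : α 0 + α 3 = α 1 + α 2) {I : Fin 4 →₀ ℕ}
    (hI : coeff I (qpoly k) ≠ 0) : Finsupp.weight α I = α 0 + α 3 := by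
  classical
  by_contra hne
  refine hI ?_
  rw [qpoly, coeff_sub, X, X, X, X, monomial_mul, monomial_mul, coeff_monomial, coeff_monomial,
    if_neg, if_neg, sub_zero]
  · rintro rfl
    apply hne
    simp [Finsupp.weight_single, hsum]
  · rintro rfl
    apply hne
    simp [Finsupp.weight_single]

theorem qpoly_mem_weightGE {α : Fin 4 → ℝ} (hsum : α 0 + α 3 = α 1 + α 2) :
    qpoly k ∈ weightGE k α (α 0 + α 3) :=
  mem_weightGE.2 fun _ hI => (coeff_qpoly_weight hsum hI).ge

theorem weightedHomogeneousComponent_qpoly {α : Fin 4 → ℝ} (hsum : α 0 + α 3 = α 1 + α 2) :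
    weightedHomogeneousComponent α (α 0 + α 3) (qpoly k) = qpoly k :=
  IsWeightedHomogeneous.weightedHomogeneousComponent_same fun _ hI => coeff_qpoly_weight hsum hI

theorem nuSup_zero (p : Fin 4 → k) {α : Fin 4 → ℝ} (hα : ∀ i, α i < 0) : nuSup k p α 0 = ⊤ := by
  refine WithTop.eq_top_iff_forall_ge.2 fun v => ?_
  simpa using le_nuSup (p := p) (fun i => (hα i).le) (zero_mem (weightGE k α v))

/-- Jacobians with two coordinates prescribed drop the valuation by less than expected. -/
theorem jac_mem_weightGE {α : Fin 4 → ℝ} (hsum : α 0 + α 3 = α 1 + α 2) (i : Fin 4) {u v : ℝ} {P S : MvPolynomial (Fin 4) k}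
    (hP : P ∈ weightGE k α u) (hS : S ∈ weightGE k α v) :
    jac k ![qpoly k, X i, P, S] ∈ weightGE k α (u + v + (α i - (α 0 + α 3))) := by
  have h := det_mem_weightGE (α := α) (u := ![α 0 + α 3, α i, u, v]) (v := α)
    (M := Matrix.of fun r j : Fin 4 => pderiv j (![qpoly k, X i, P, S] r)) fun r j => by
      fin_cases r
      · exact pderiv_mem_weightGE (qpoly_mem_weightGE hsum) j
      · exact pderiv_mem_weightGE (X_mem_weightGE i) j
      · exact pderiv_mem_weightGE hP j
      · exact pderiv_mem_weightGE hS j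
  refine weightGE_anti (le_of_eq ?_) h
  simp only [Fin.sum_univ_four, Matrix.cons_val]
  linarith

variable {α : Fin 4 → ℝ} (hα : ∀ i, α i < 0) (hsum : α 0 + α 3 = α 1 + α 2)

include hα hsum

theorem qpoly_sub_one_mem_weightGE : qpoly k - 1 ∈ weightGE k α (α 0 + α 3) := by
  refine sub_mem (qpoly_mem_weightGE hsum) (weightGE_anti ?_ (C_mem_weightGE (1 : k)))
  linarith [hα 0, hα 3]

theorem weightedHomogeneousComponent_qpoly_sub_one :
    weightedHomogeneousComponent α (α 0 + α 3) (qpoly k - 1) = qpoly k := by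
  rw [map_sub, weightedHomogeneousComponent_qpoly hsum,
    ← C_1,
    weightedHomogeneousComponent_eq_zero_of_mem (C_mem_weightGE (1 : k)), sub_zero]
  linarith [hα 0, hα 3]

/-- A lift whose leading form is not divisible by `q` computes the valuation `nuSup`. -/
theorem nuSup_eq_of_not_dvd (p : Fin 4 → k) {m : ℝ} {P : MvPolynomial (Fin 4) k}
    (hP : P ∈ weightGE k α m) (hdvd : ¬ qpoly k ∣ weightedHomogeneousComponent α m P) :
    nuSup k p α (qmk k P) = m := by
  have hα' : ∀ i, α i ≤ 0 := fun i => (hα i).le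
  refine le_antisymm ((isLUB_nuSup p α _).2 ?_) (le_nuSup hα' hP)
  rintro _ ⟨S, hS, rfl⟩
  by_contra! hlt
  obtain ⟨w, hw, hmw⟩ : ∃ w : ℝ, S ∈ weightGE k α w ∧ m < w := by
    cases hval : mvalP k p α S with
    | top => exact ⟨m + 1, (le_mvalP_iff hα').1 (hval ▸ le_top), by linarith⟩
    | coe w => exact ⟨w, (le_mvalP_iff hα').1 hval.ge, by simpa [hval] using hlt⟩
  obtain ⟨H, rfl⟩ := qmk_eq_qmk_iff.1 hS.symm
  rw [map_add, weightedHomogeneousComponent_eq_zero_of_mem hw hmw, zero_add] at hdvd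
  have hH : H ≠ 0 := by
    rintro rfl
    simp at hdvd
  obtain ⟨h, hHh, hHne⟩ := exists_weightedHomogeneousComponent_ne_zero α hH
  have hq := qpoly_sub_one_mem_weightGE (k := k) hα hsum
  have hlead := weightedHomogeneousComponent_mul_of_mem hq hHh
  rw [weightedHomogeneousComponent_qpoly_sub_one hα hsum] at hlead
  rcases lt_trichotomy m (α 0 + α 3 + h) with hlt | heq | hgt
  · rw [weightedHomogeneousComponent_eq_zero_of_mem (mul_mem_weightGE hq hHh) hlt] at hdvd
    exact hdvd (dvd_zero _)
  · rw [heq, hlead] at hdvd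
    exact hdvd (dvd_mul_right _ _)
  · have hmem : (qpoly k - 1) * H ∈ weightGE k α m := by
      have := sub_mem hP (weightGE_anti hmw.le hw)
      rwa [add_sub_cancel_left] at this
    rw [weightedHomogeneousComponent_eq_zero_of_mem hmem hgt] at hlead
    exact mul_ne_zero (prime_qpoly k).ne_zero hHne hlead.symm

/-- Every nonzero element of `k[Q]` has a lift whose leading form is not divisible by `q`. -/
theorem exists_lift_not_dvd {f : QuadRing k} (hf : f ≠ 0) :
    ∃ (P : MvPolynomial (Fin 4) k) (m : ℝ), qmk k P = f ∧ m ≤ 0 ∧ P ∈ weightGE k α m ∧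
      ¬ qpoly k ∣ weightedHomogeneousComponent α m P := by
  classical
  have hne : ∀ P, qmk k P = f → P ≠ 0 := by
    rintro P hP rfl
    exact hf (by rw [← hP, map_zero])
  obtain ⟨P₀, hP₀⟩ : ∃ P, qmk k P = f := Ideal.Quotient.mk_surjective f
  obtain ⟨m₀, hm₀, hlead₀⟩ := exists_weightedHomogeneousComponent_ne_zero α (hne P₀ hP₀)
  let T : Set ℝ := {m | m₀ ≤ m ∧ ∃ P, qmk k P = f ∧ P ∈ weightGE k α m ∧
    weightedHomogeneousComponent α m P ≠ 0}
  have hTfin : T.Finite := by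
    refine ((finite_setOf_le_weight hα m₀).image (Finsupp.weight α)).subset ?_
    rintro m ⟨hm, P, -, -, hP⟩
    obtain ⟨I, -, rfl⟩ := exists_weight_eq_of_weightedHomogeneousComponent_ne_zero hP
    exact ⟨I, hm, rfl⟩
  obtain ⟨m, ⟨hm, P, hPf, hPm, hPne⟩, hmax⟩ :=
    hTfin.exists_maximal ⟨m₀, le_rfl, P₀, hP₀, hm₀, hlead₀⟩
  refine ⟨P, m, hPf, ?_, hPm, ?_⟩
  · obtain ⟨I, -, rfl⟩ := exists_weight_eq_of_weightedHomogeneousComponent_ne_zero hPne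
    rw [Finsupp.weight_eq_sum]
    exact Finset.sum_nonpos fun i _ => nsmul_nonpos (hα i).le _
  rintro ⟨H, hH⟩
  set H' := weightedHomogeneousComponent α (m - (α 0 + α 3)) H with hH'
  have hH'hom : H'.IsWeightedHomogeneous α (m - (α 0 + α 3)) :=
    weightedHomogeneousComponent_isWeightedHomogeneous _ _
  have hH'mem : H' ∈ weightGE k α (m - (α 0 + α 3)) :=
    mem_weightGE.2 fun I hI => (hH'hom hI).ge
  have hq := qpoly_sub_one_mem_weightGE (k := k) hα hsum
  have hmem := mul_mem_weightGE hq hH'mem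
  have hcomp := weightedHomogeneousComponent_mul_of_mem hq hH'mem
  rw [add_sub_cancel] at hmem hcomp
  have hqH : weightedHomogeneousComponent α m P = qpoly k * H' := by
    have hmul : weightedHomogeneousComponent α (α 0 + α 3 + (m - (α 0 + α 3))) (qpoly k * H) =
        weightedHomogeneousComponent α (α 0 + α 3) (qpoly k) * H' :=
      weightedHomogeneousComponent_mul fun J K hJ _ h => by
        have := coeff_qpoly_weight hsum hJ
        exact ⟨this, by linarith⟩
    rw [add_sub_cancel, ← hH, weightedHomogeneousComponent_qpoly hsum] at hmul
    rw [← hmul]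
    exact (IsWeightedHomogeneous.weightedHomogeneousComponent_same
      (weightedHomogeneousComponent_isWeightedHomogeneous _ _)).symm
  rw [weightedHomogeneousComponent_qpoly_sub_one hα hsum,
    IsWeightedHomogeneous.weightedHomogeneousComponent_same hH'hom, ← hqH] at hcomp
  have hSf : qmk k (P - (qpoly k - 1) * H') = f := by
    rw [map_sub, map_mul, qmk_qpoly_sub_one, zero_mul, sub_zero, hPf]
  have hSmem := sub_mem hPm hmem
  obtain ⟨m', hm', hlead'⟩ := exists_weightedHomogeneousComponent_ne_zero α (hne _ hSf)
  have hle : m ≤ m' := by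
    by_contra! hlt
    exact hlead' (weightedHomogeneousComponent_eq_zero_of_mem hSmem hlt)
  have hge : m' ≤ m := hmax ⟨hm.trans hle, _, hSf, hm', hlead'⟩ hle
  apply hlead'
  rw [le_antisymm hge hle, map_sub, hcomp, sub_self]

theorem nuSup_mul (p : Fin 4 → k) {f g : QuadRing k} (hf : f ≠ 0) (hg : g ≠ 0) :
    nuSup k p α (f * g) = nuSup k p α f + nuSup k p α g := by
  obtain ⟨P, m, rfl, -, hP, hPd⟩ := exists_lift_not_dvd hα hsum hf
  obtain ⟨S, l, rfl, -, hS, hSd⟩ := exists_lift_not_dvd hα hsum hg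
  rw [nuSup_eq_of_not_dvd hα hsum p hP hPd, nuSup_eq_of_not_dvd hα hsum p hS hSd, ← map_mul,
    nuSup_eq_of_not_dvd hα hsum p (mul_mem_weightGE hP hS) _, WithTop.coe_add]
  rw [weightedHomogeneousComponent_mul_of_mem hP hS]
  exact fun h => ((prime_qpoly k).dvd_or_dvd h).elim hPd hSd

end QuadricValuation

theorem pderiv_aeval_pair {k σ : Type*} [CommRing k] (P S : MvPolynomial σ k) (j : σ)
    (R : MvPolynomial (Fin 2) k) :
    pderiv j (aeval ![P, S] R) =
      aeval ![P, S] (pderiv 0 R) * pderiv j P + aeval ![P, S] (pderiv 1 R) * pderiv j S := by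
  induction R using MvPolynomial.induction_on with
  | C c => simp [← algebraMap_eq]
  | add R T hR hT => simp only [map_add, hR, hT]; ring
  | mul_X R i hR =>
    simp only [map_mul, aeval_X, Derivation.leibniz, hR, smul_eq_mul, map_add, pderiv_X]
    fin_cases i <;> simp <;> ring

theorem det_vec_four_row_ops {A : Type*} [CommRing A] (q e r s : Fin 4 → A) (h h' g g' : A) :
    (Matrix.of ![q, e, r + h • q, g' • r + g • s + h' • q]).det =
      g * (Matrix.of ![q, e, r, s]).det := by
  simp [Matrix.det_succ_row_zero, Fin.sum_univ_succ, Fin.succAbove]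
  ring

theorem qmk_aeval {k : Type} [Field k] (P S : MvPolynomial (Fin 4) k) (R : MvPolynomial (Fin 2) k) :
    qmk k (aeval ![P, S] R) = aeval ![qmk k P, qmk k S] R := by
  have h := comp_aeval_apply ![P, S] (Ideal.Quotient.mkₐ k (Ideal.span {qpoly k - 1})) R
  refine h.trans ?_
  congr 2
  ext i
  fin_cases i <;> rfl

theorem qmk_pderiv_add_qpoly_mul {k : Type} [Field k] (P H : MvPolynomial (Fin 4) k) (j : Fin 4) :
    qmk k (pderiv j (P + (qpoly k - 1) * H)) =
      qmk k (pderiv j P) + qmk k H * qmk k (pderiv j (qpoly k)) := by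
  rw [map_add, Derivation.leibniz, map_sub, pderiv_one, sub_zero, smul_eq_mul, smul_eq_mul]
  simp only [map_add, map_mul, qmk_qpoly_sub_one, zero_mul, zero_add]

theorem qmk_jac {k : Type} [Field k] (P₀ P₁ P₂ P₃ : MvPolynomial (Fin 4) k) :
    qmk k (jac k ![P₀, P₁, P₂, P₃]) =
      (Matrix.of ![fun j => qmk k (pderiv j P₀), fun j => qmk k (pderiv j P₁),
        fun j => qmk k (pderiv j P₂), fun j => qmk k (pderiv j P₃)]).det := by
  rw [jac, RingHom.map_det]
  congr 1
  ext i j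
  fin_cases i <;> rfl

/-- The chain rule `j(xᵢ, f₁, R(f₁, f₂)) = (∂_Y R)(f₁, f₂) · j(xᵢ, f₁, f₂)`, for arbitrary lifts. -/
theorem qmk_jac_aeval {k : Type} [Field k] {P P' S T : MvPolynomial (Fin 4) k}
    {R : MvPolynomial (Fin 2) k} (hP : qmk k P' = qmk k P)
    (hT : qmk k T = aeval ![qmk k P, qmk k S] R) (i : Fin 4) :
    qmk k (jac k ![qpoly k, X i, P', T]) =
      aeval ![qmk k P, qmk k S] (pderiv 1 R) * qmk k (jac k ![qpoly k, X i, P, S]) := by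
  obtain ⟨H, rfl⟩ := qmk_eq_qmk_iff.1 hP
  obtain ⟨H', rfl⟩ := qmk_eq_qmk_iff.1 (hT.trans (qmk_aeval P S R).symm)
  rw [qmk_jac, qmk_jac, ← det_vec_four_row_ops _ _ _ _ (qmk k H) (qmk k H')
    (aeval ![qmk k P, qmk k S] (pderiv 1 R)) (aeval ![qmk k P, qmk k S] (pderiv 0 R))]
  congr 1
  ext r j
  fin_cases r
  · rfl
  · rfl
  · exact qmk_pderiv_add_qpoly_mul P H j
  · refine (qmk_pderiv_add_qpoly_mul _ H' j).trans ?_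
    rw [pderiv_aeval_pair, map_add, map_mul, map_mul, qmk_aeval, qmk_aeval]
    rfl

theorem degreeOf_le_degreeOf_pderiv_add_one {k σ : Type*} [CommRing k] [IsDomain k] [CharZero k]
    (i : σ) (R : MvPolynomial σ k) : R.degreeOf i ≤ (pderiv i R).degreeOf i + 1 := by
  rw [degreeOf_le_iff]
  intro I hI
  rcases Nat.eq_zero_or_pos (I i) with h0 | hpos
  · omega
  have hsplit : I - Finsupp.single i 1 + Finsupp.single i 1 = I :=
    tsub_add_cancel_of_le (Finsupp.single_le_iff.2 hpos)
  have hmem : I - Finsupp.single i 1 ∈ (pderiv i R).support := by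
    rw [mem_support_iff, coeff_pderiv, hsplit]
    exact mul_ne_zero (mem_support_iff.1 hI) (Nat.cast_add_one_ne_zero _)
  have := monomial_le_degreeOf i hmem
  simp at this
  omega

theorem degreeOf_le_degreeOf_iterate_pderiv_add {k σ : Type*} [CommRing k] [IsDomain k]
    [CharZero k] (i : σ) (n : ℕ) (R : MvPolynomial σ k) :
    R.degreeOf i ≤ ((fun S : MvPolynomial σ k => pderiv i S)^[n] R).degreeOf i + n := by
  induction n generalizing R with
  | zero => simp
  | succ n ih =>
    have h1 := degreeOf_le_degreeOf_pderiv_add_one i R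
    have h2 := ih (pderiv i R)
    rw [Function.iterate_succ_apply]
    omega

theorem mval2_le_degreeOf_mul {k : Type} [Field k] {a b : ℝ} (ha : a ≤ 0)
    {R : MvPolynomial (Fin 2) k} (hR : R ≠ 0) :
    mval2 k ![a, b] R ≤ ((R.degreeOf 1 * b : ℝ) : WithTop ℝ) := by
  classical
  obtain ⟨I, hI, hmax⟩ := R.support.exists_mem_eq_sup (support_nonempty.2 hR) fun I => I 1
  rw [← degreeOf_eq_sup] at hmax
  refine (Finset.inf_le hI).trans (WithTop.coe_le_coe.2 ?_)
  rw [hmax, Fin.sum_univ_two]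
  simp only [Matrix.cons_val_zero, Matrix.cons_val_one]
  linarith [mul_nonpos_of_nonpos_of_nonneg ha (Nat.cast_nonneg (α := ℝ) (I 0))]

section Parachute

variable {k : Type} [Field k] {α : Fin 4 → ℝ} (hα : ∀ i, α i < 0)
  (hsum : α 0 + α 3 = α 1 + α 2)

include hα hsum

theorem exists_nuSup_eq_coe (p : Fin 4 → k) {f : QuadRing k} (hf : f ≠ 0) :
    ∃ m : ℝ, m ≤ 0 ∧ nuSup k p α f = m := by
  obtain ⟨P, m, rfl, hm, hP, hPd⟩ := exists_lift_not_dvd hα hsum hf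
  exact ⟨m, hm, nuSup_eq_of_not_dvd hα hsum p hP hPd⟩

theorem nuSup_aeval_lt (p : Fin 4 → k) {P S : MvPolynomial (Fin 4) k} {R : MvPolynomial (Fin 2) k}
    (hP : qmk k P ≠ 0) (hR : aeval ![qmk k P, qmk k S] R ≠ 0)
    (hdR : aeval ![qmk k P, qmk k S] (pderiv 1 R) ≠ 0) {a c r s : ℝ}
    (ha : nuSup k p α (qmk k P) = a) {i : Fin 4}
    (hc : nuSup k p α (qmk k (jac k ![qpoly k, X i, P, S])) = c)
    (hr : nuSup k p α (aeval ![qmk k P, qmk k S] R) = r)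
    (hs : nuSup k p α (aeval ![qmk k P, qmk k S] (pderiv 1 R)) = s) :
    r < s + (c - a) := by
  obtain ⟨P', m, hP', -, hPm, hPd⟩ := exists_lift_not_dvd hα hsum hP
  obtain ⟨T, l, hT, -, hTl, hTd⟩ := exists_lift_not_dvd hα hsum hR
  have hma : m = a := by
    rw [← hP', nuSup_eq_of_not_dvd hα hsum p hPm hPd] at ha
    exact_mod_cast ha
  have hlr : l = r := by
    rw [← hT, nuSup_eq_of_not_dvd hα hsum p hTl hTd] at hr
    exact_mod_cast hr
  subst hma hlr
  have hj : qmk k (jac k ![qpoly k, X i, P, S]) ≠ 0 := by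
    intro h
    rw [h, nuSup_zero p hα] at hc
    exact WithTop.top_ne_coe hc
  have hle := le_nuSup (p := p) (fun i => (hα i).le) (jac_mem_weightGE hsum i hPm hTl)
  rw [qmk_jac_aeval hP' hT i, nuSup_mul hα hsum p hdR hj, hs, hc, ← WithTop.coe_add,
    WithTop.coe_le_coe] at hle
  have hpos : 0 < α i - (α 0 + α 3) := by
    have h0 := hα 0
    have h1 := hα 1
    have h2 := hα 2
    have h3 := hα 3
    fin_cases i <;> simp <;> linarith
  linarith

theorem nuSup_aeval_le_iterate (p : Fin 4 → k) {P S : MvPolynomial (Fin 4) k}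
    (hind : AlgebraicIndependent k ![qmk k P, qmk k S]) {a c : ℝ}
    (ha : nuSup k p α (qmk k P) = a) {i : Fin 4}
    (hc : nuSup k p α (qmk k (jac k ![qpoly k, X i, P, S])) = c) (n : ℕ)
    {R : MvPolynomial (Fin 2) k} {r s : ℝ}
    (hR : (fun T : MvPolynomial (Fin 2) k => pderiv (1 : Fin 2) T)^[n] R ≠ 0)
    (hr : nuSup k p α (aeval ![qmk k P, qmk k S] R) = r)
    (hs : nuSup k p α (aeval ![qmk k P, qmk k S]
      ((fun T : MvPolynomial (Fin 2) k => pderiv (1 : Fin 2) T)^[n] R)) = s) :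
    r ≤ s + n * (c - a) ∧ (1 ≤ n → r < s + n * (c - a)) := by
  have hne : ∀ T : MvPolynomial (Fin 2) k, T ≠ 0 → aeval ![qmk k P, qmk k S] T ≠ 0 :=
    fun T hT h => hT (hind.eq_zero_of_aeval_eq_zero T h)
  have hP : qmk k P ≠ 0 := hind.ne_zero 0
  induction n generalizing R r with
  | zero =>
    have : r = s := by exact_mod_cast hr.symm.trans hs
    simp [this]
  | succ n ih =>
    rw [Function.iterate_succ_apply] at hR hs
    have hdR : pderiv 1 R ≠ 0 := by
      intro h
      rw [h, Function.iterate_fixed (map_zero _)] at hR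
      exact hR rfl
    have hR0 : R ≠ 0 := by
      rintro rfl
      exact hdR (map_zero _)
    obtain ⟨t, -, ht⟩ := exists_nuSup_eq_coe hα hsum p (hne _ hdR)
    have hstep := nuSup_aeval_lt hα hsum p hP (hne _ hR0) (hne _ hdR) ha hc hr ht
    have hrest := (ih hR ht hs).1
    have hlt : r < s + ((n + 1 : ℕ) : ℝ) * (c - a) := by
      push_cast
      linarith
    exact ⟨hlt.le, fun _ => hlt⟩

end Parachute

/-- Lemma 4.12: let `ν ∈ 𝒱₀`, let `f₁, f₂ ∈ k[Q]` be algebraically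
independent with `ν(f₁) = a`, `ν(f₂) = b`, and parachute `∇(f₁,f₂) = c - a - b`
(where `c` is the min of the values of the four pseudo-jacobians). If `n ≥ 1`,
`∂_Y^n R ≠ 0` and `ν((∂_Y^n R)(f₁,f₂))` equals the monomial valuation of `∂_Y^n R` with
weights `(a, b)`, then `ν(R(f₁,f₂)) < deg_Y(R)·ν(f₂) + n·∇(f₁,f₂)`. -/
theorem parachute_inequality (k : Type) [Field k] [IsAlgClosed k] [CharZero k]
    (ν : QuadRing k → WithTop ℝ) (hν : ν ∈ V0 k)
    (f1 f2 : QuadRing k)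
    (hind : AlgebraicIndependent k ![f1, f2])
    (R1 R2 : MvPolynomial (Fin 4) k)
    (h1 : qmk k R1 = f1) (h2 : qmk k R2 = f2)
    (a b c : ℝ) (ha : ν f1 = (a : WithTop ℝ)) (hb : ν f2 = (b : WithTop ℝ))
    (hc : min (min (ν (qmk k (jac k ![qpoly k, X 0, R1, R2])))
               (ν (qmk k (jac k ![qpoly k, X 1, R1, R2]))))
          (min (ν (qmk k (jac k ![qpoly k, X 2, R1, R2])))
               (ν (qmk k (jac k ![qpoly k, X 3, R1, R2])))) = (c : WithTop ℝ))
    (R : MvPolynomial (Fin 2) k) (n : ℕ) (hn : 1 ≤ n)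
    (hder : (fun S : MvPolynomial (Fin 2) k => pderiv (1 : Fin 2) S)^[n] R ≠ 0)
    (hmon : ν (MvPolynomial.aeval ![f1, f2]
          ((fun S : MvPolynomial (Fin 2) k => pderiv (1 : Fin 2) S)^[n] R))
        = mval2 k ![a, b]
          ((fun S : MvPolynomial (Fin 2) k => pderiv (1 : Fin 2) S)^[n] R)) :
    ν (MvPolynomial.aeval ![f1, f2] R)
      < (((R.degreeOf 1 : ℝ) * b + (n : ℝ) * (c - a - b) : ℝ) : WithTop ℝ) := by
  obtain ⟨p, α, hα, hsum, rfl⟩ := hν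
  subst h1 h2
  have hne : ∀ T : MvPolynomial (Fin 2) k, T ≠ 0 → aeval ![qmk k R1, qmk k R2] T ≠ 0 :=
    fun T hT h => hT (hind.eq_zero_of_aeval_eq_zero T h)
  have hval : ∀ {f : QuadRing k} {m : ℝ}, f ≠ 0 → nuSup k p α f = m → m ≤ 0 := by
    intro f m hf hm
    obtain ⟨l, hl, hfl⟩ := exists_nuSup_eq_coe hα hsum p hf
    have : m = l := by exact_mod_cast hm.symm.trans hfl
    exact this ▸ hl
  have ha0 : a ≤ 0 := hval (hind.ne_zero 0) ha
  have hb0 : b ≤ 0 := hval (hind.ne_zero 1) hb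
  obtain ⟨i, hi⟩ : ∃ i, nuSup k p α (qmk k (jac k ![qpoly k, X i, R1, R2])) = c := by
    rw [← hc]
    rcases min_choice
      (min (nuSup k p α (qmk k (jac k ![qpoly k, X 0, R1, R2])))
        (nuSup k p α (qmk k (jac k ![qpoly k, X 1, R1, R2]))))
      (min (nuSup k p α (qmk k (jac k ![qpoly k, X 2, R1, R2])))
        (nuSup k p α (qmk k (jac k ![qpoly k, X 3, R1, R2])))) with h | h <;> rw [h]
    · rcases min_choice (nuSup k p α (qmk k (jac k ![qpoly k, X 0, R1, R2])))
        (nuSup k p α (qmk k (jac k ![qpoly k, X 1, R1, R2]))) with h | h <;> rw [h]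
      exacts [⟨0, rfl⟩, ⟨1, rfl⟩]
    · rcases min_choice (nuSup k p α (qmk k (jac k ![qpoly k, X 2, R1, R2])))
        (nuSup k p α (qmk k (jac k ![qpoly k, X 3, R1, R2]))) with h | h <;> rw [h]
      exacts [⟨2, rfl⟩, ⟨3, rfl⟩]
  have hR : R ≠ 0 := by
    rintro rfl
    exact hder (Function.iterate_fixed (map_zero _) n)
  obtain ⟨r, -, hr⟩ := exists_nuSup_eq_coe hα hsum p (hne _ hR)
  obtain ⟨s, -, hs⟩ := exists_nuSup_eq_coe hα hsum p (hne _ hder)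
  have hlt := (nuSup_aeval_le_iterate hα hsum p hind ha hi n hder hr hs).2 hn
  have hsb := mval2_le_degreeOf_mul (b := b) ha0 hder
  rw [← hmon, hs, WithTop.coe_le_coe] at hsb
  have hdeg : (R.degreeOf 1 : ℝ) ≤
      ((fun S : MvPolynomial (Fin 2) k => pderiv (1 : Fin 2) S)^[n] R).degreeOf 1 + n := by
    exact_mod_cast degreeOf_le_degreeOf_iterate_pderiv_add 1 n R
  rw [hr, WithTop.coe_lt_coe]
  linarith [mul_le_mul_of_nonpos_right hdeg hb0]
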